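/- Let W_B be the subgroup of Aut(Pic) generated by s0 = w0, s1 = w2, s2 = w3, s3 = σ3 (a realization of the affine Weyl group of type B3^(1) with simple roots b0 = α0, b1 = α2, b2 = α3, b3 = (α1−α3)/2). Then the stabilizer {w ∈ W_B : w(α2) = α2} of the root b1 = α2 equals the subgroup generated by the four elements s0, s2∘s1∘s3∘s2∘s3∘s1∘s2, s3, and s2∘s1∘s0∘s2∘s3∘s2∘s0∘s1∘s2; moreover each of s0 and s2∘s1∘s3∘s2∘s3∘s1∘s2 commutes with each of s3 and s2∘s1∘s0∘s2∘s3∘s2∘s0∘s1∘s2, so this stabilizer is the direct product of the two subgroups ⟨s0, s2∘s1∘s3∘s2∘s3∘s1∘s2⟩ and ⟨s3, s2∘s1∘s0∘s2∘s3∘s2∘s0∘s1∘s2⟩. -/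

import Mathlib

open Pointwise

/-- The Picard lattice `Pic`, with basis `H1, H2, E1, …, E8`
(coordinates `0 ↦ H1`, `1 ↦ H2`, `i+1 ↦ Eᵢ`). -/
abbrev Pic : Type := Fin 10 → ℤ

/-- The intersection form `•` : `H1•H2 = 1`, `Eᵢ•Eᵢ = -1`, all other pairings
of basis vectors being `0`. -/
def inter (x y : Pic) : ℤ :=
  x 0 * y 1 + x 1 * y 0 -
    (x 2 * y 2 + x 3 * y 3 + x 4 * y 4 + x 5 * y 5 + x 6 * y 6 +
      x 7 * y 7 + x 8 * y 8 + x 9 * y 9)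

/-- The `j`-th basis vector of `Pic`. -/
def bvec (j : Fin 10) : Pic := fun k => if k = j then 1 else 0

/-- The matrix of the reflection `C ↦ C + (C • a)·a` in `a`. -/
def reflMat (a : Pic) : Matrix (Fin 10) (Fin 10) ℤ :=
  Matrix.of fun k j => (if k = j then 1 else 0) + inter (bvec j) a * a k

/-- The matrix of the linear map sending the basis vector `e j` to `e (p j)`. -/
def permMat (p : Fin 10 → Fin 10) : Matrix (Fin 10) (Fin 10) ℤ :=
  Matrix.of fun k j => if p j = k then 1 else 0

/-- `α₀ = H2 - E1 - E2`. -/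
def al0 : Pic := ![0, 1, -1, -1, 0, 0, 0, 0, 0, 0]
/-- `α₁ = H1 - E5 - E6`. -/
def al1 : Pic := ![1, 0, 0, 0, 0, 0, -1, -1, 0, 0]
/-- `α₂ = H2 - E3 - E4`. -/
def al2 : Pic := ![0, 1, 0, 0, -1, -1, 0, 0, 0, 0]
/-- `α₃ = H1 - E7 - E8`. -/
def al3 : Pic := ![1, 0, 0, 0, 0, 0, 0, 0, -1, -1]
/-- `δ = 2H1 + 2H2 - E1 - ⋯ - E8`. -/
def dl : Pic := ![2, 2, -1, -1, -1, -1, -1, -1, -1, -1]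
/-- `μ = H1 - H2`. -/
def mu : Pic := ![1, -1, 0, 0, 0, 0, 0, 0, 0, 0]

/-- Automorphisms of the lattice `Pic`, realized as invertible integer `10 × 10`
matrices (acting on coordinate vectors by matrix-vector multiplication). -/
abbrev PicAut : Type := (Matrix (Fin 10) (Fin 10) ℤ)ˣ

/-- Build an automorphism of `Pic` out of an involutive matrix. -/
def mkAut (M : Matrix (Fin 10) (Fin 10) ℤ) (h : M * M = 1) : PicAut := ⟨M, M, h, h⟩

/-- `w₀`, the reflection `C ↦ C + (C•α₀)α₀`. -/
def w0 : PicAut := mkAut (reflMat al0) (by decide)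
/-- `w₁`, the reflection `C ↦ C + (C•α₁)α₁`. -/
def w1 : PicAut := mkAut (reflMat al1) (by decide)
/-- `w₂`, the reflection `C ↦ C + (C•α₂)α₂`. -/
def w2 : PicAut := mkAut (reflMat al2) (by decide)
/-- `w₃`, the reflection `C ↦ C + (C•α₃)α₃`. -/
def w3 : PicAut := mkAut (reflMat al3) (by decide)
/-- `σ₁`: the basis permutation `E1↔E7, E2↔E8, E3↔E5, E4↔E6` (fixing `H1`, `H2`)
composed with the reflection `w_μ` in `μ = H1 - H2`. -/
def sg1 : PicAut := mkAut (permMat ![0, 1, 8, 9, 6, 7, 4, 5, 2, 3] * reflMat mu) (by decide)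
/-- `σ₂`: the basis permutation `E1↔E3, E2↔E4` (fixing the other basis vectors). -/
def sg2 : PicAut := mkAut (permMat ![0, 1, 4, 5, 2, 3, 6, 7, 8, 9]) (by decide)
/-- `σ₃`: the basis permutation `E5↔E7, E6↔E8` (fixing the other basis vectors). -/
def sg3 : PicAut := mkAut (permMat ![0, 1, 2, 3, 4, 5, 8, 9, 6, 7]) (by decide)

/-- The action of an automorphism on `Pic`. -/
def act (g : PicAut) (v : Pic) : Pic := g.val.mulVec v

instance : MulAction PicAut Pic where
  smul := act
  one_smul v := by
    show act 1 v = v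
    simp [act]
  mul_smul g h v := by
    show act (g * h) v = act g (act h v)
    simp [act, Matrix.mulVec_mulVec]

lemma smul_eq_act (g : PicAut) (v : Pic) : g • v = act g v := rfl

/-- The fully extended affine Weyl group `Ŵ` of type `A₃⁽¹⁾`, i.e. the subgroup
of automorphisms of `Pic` generated by `w₀, w₁, w₂, w₃, σ₁, σ₂`. -/
def Wh : Subgroup PicAut := Subgroup.closure {w0, w1, w2, w3, sg1, sg2}

/-- `W_B`, the affine Weyl group of type `B₃⁽¹⁾`, generated by
`s₀ = w₀, s₁ = w₂, s₂ = w₃, s₃ = σ₃`. -/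
def WB : Subgroup PicAut := Subgroup.closure {w0, w2, w3, sg3}

/-- `s₂s₁s₃s₂s₃s₁s₂`. -/
def a2e : PicAut := w3 * w2 * sg3 * w3 * sg3 * w2 * w3
/-- `s₂s₁s₀s₂s₃s₂s₀s₁s₂`. -/
def b2e : PicAut := w3 * w2 * w0 * w3 * sg3 * w3 * w0 * w2 * w3

/-- The element `s₂s₀s₁s₃s₂`, which sends `α₂` to `δ - α₂`. -/
def rho : PicAut := w3 * w0 * w2 * sg3 * w3

lemma act_one (v : Pic) : act 1 v = v := by simp [act]

lemma act_mul (g h : PicAut) (v : Pic) : act (g * h) v = act g (act h v) := by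
  simp [act, Matrix.mulVec_mulVec]

lemma act_add (g : PicAut) (v w : Pic) : act g (v + w) = act g v + act g w :=
  Matrix.mulVec_add _ _ _

lemma act_neg (g : PicAut) (v : Pic) : act g (-v) = -act g v :=
  Matrix.mulVec_neg _ _

lemma act_zsmul (g : PicAut) (k : ℤ) (v : Pic) : act g (k • v) = k • act g v :=
  Matrix.mulVec_smul _ _ _

lemma PicAut.ext_act {g h : PicAut} (H : ∀ v : Pic, act g v = act h v) : g = h :=
  Units.ext (Matrix.mulVec_injective (funext H))

lemma act_w0 (v : Pic) : act w0 v =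
    ![v 0, v 0 + v 1 + v 2 + v 3, - v 0 - v 3, - v 0 - v 2,
      v 4, v 5, v 6, v 7, v 8, v 9] := by
  ext i
  fin_cases i <;>
    simp [act, w0, mkAut, reflMat, inter, bvec, al0, Matrix.mulVec, dotProduct,
      Fin.sum_univ_succ] <;> ring

lemma act_w2 (v : Pic) : act w2 v =
    ![v 0, v 0 + v 1 + v 4 + v 5, v 2, v 3, - v 0 - v 5, - v 0 - v 4,
      v 6, v 7, v 8, v 9] := by
  ext i
  fin_cases i <;>
    simp [act, w2, mkAut, reflMat, inter, bvec, al2, Matrix.mulVec, dotProduct,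
      Fin.sum_univ_succ] <;> ring

lemma act_w3 (v : Pic) : act w3 v =
    ![v 0 + v 1 + v 8 + v 9, v 1, v 2, v 3, v 4, v 5, v 6, v 7, - v 1 - v 9, - v 1 - v 8] := by
  ext i
  fin_cases i <;>
    simp [act, w3, mkAut, reflMat, inter, bvec, al3, Matrix.mulVec, dotProduct,
      Fin.sum_univ_succ] <;> ring

lemma act_sg3 (v : Pic) : act sg3 v =
    ![v 0, v 1, v 2, v 3, v 4, v 5, v 8, v 9, v 6, v 7] := by
  ext i
  fin_cases i <;>
    simp [act, sg3, mkAut, permMat, Matrix.mulVec, dotProduct, Fin.sum_univ_succ]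

lemma act_a2e (v : Pic) : act a2e v =
    ![3 * v 0 + 4 * v 1 + 2 * v 4 + 2 * v 5 + 2 * v 6 + 2 * v 7 + 2 * v 8 + 2 * v 9,
      v 0 + 3 * v 1 + v 4 + v 5 + v 6 + v 7 + v 8 + v 9,
      v 2,
      v 3,
      - v 0 - 2 * v 1 - v 5 - v 6 - v 7 - v 8 - v 9,
      - v 0 - 2 * v 1 - v 4 - v 6 - v 7 - v 8 - v 9,
      - v 0 - 2 * v 1 - v 4 - v 5 - v 7 - v 8 - v 9,
      - v 0 - 2 * v 1 - v 4 - v 5 - v 6 - v 8 - v 9,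
      - v 0 - 2 * v 1 - v 4 - v 5 - v 6 - v 7 - v 9,
      - v 0 - 2 * v 1 - v 4 - v 5 - v 6 - v 7 - v 8] := by
  ext i
  fin_cases i <;> simp [a2e, act_mul, act_w2, act_w3, act_sg3] <;> ring

lemma act_b2e (v : Pic) : act b2e v =
    ![9 * v 0 + 8 * v 1 + 4 * v 2 + 4 * v 3 + 4 * v 4 + 4 * v 5 + 2 * v 6 + 2 * v 7 +
        6 * v 8 + 6 * v 9,
      8 * v 0 + 9 * v 1 + 4 * v 2 + 4 * v 3 + 4 * v 4 + 4 * v 5 + 2 * v 6 + 2 * v 7 +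
        6 * v 8 + 6 * v 9,
      - 4 * v 0 - 4 * v 1 - v 2 - 2 * v 3 - 2 * v 4 - 2 * v 5 - v 6 - v 7 - 3 * v 8 -
        3 * v 9,
      - 4 * v 0 - 4 * v 1 - 2 * v 2 - v 3 - 2 * v 4 - 2 * v 5 - v 6 - v 7 - 3 * v 8 -
        3 * v 9,
      - 4 * v 0 - 4 * v 1 - 2 * v 2 - 2 * v 3 - v 4 - 2 * v 5 - v 6 - v 7 - 3 * v 8 -
        3 * v 9,
      - 4 * v 0 - 4 * v 1 - 2 * v 2 - 2 * v 3 - 2 * v 4 - v 5 - v 6 - v 7 - 3 * v 8 -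
        3 * v 9,
      - 2 * v 0 - 2 * v 1 - v 2 - v 3 - v 4 - v 5 - v 8 - 2 * v 9,
      - 2 * v 0 - 2 * v 1 - v 2 - v 3 - v 4 - v 5 - 2 * v 8 - v 9,
      - 6 * v 0 - 6 * v 1 - 3 * v 2 - 3 * v 3 - 3 * v 4 - 3 * v 5 - v 6 - 2 * v 7 - 4
        * v 8 - 4 * v 9,
      - 6 * v 0 - 6 * v 1 - 3 * v 2 - 3 * v 3 - 3 * v 4 - 3 * v 5 - 2 * v 6 - v 7 - 4
        * v 8 - 4 * v 9] := by
  ext i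
  fin_cases i <;> simp [b2e, act_mul, act_w0, act_w2, act_w3, act_sg3] <;> ring

lemma act_rho (v : Pic) : act rho v =
    ![3 * v 0 + 4 * v 1 + v 2 + v 3 + v 4 + v 5 + v 6 + v 7 + 3 * v 8 + 3 * v 9,
      2 * v 0 + 3 * v 1 + v 2 + v 3 + v 4 + v 5 + 2 * v 8 + 2 * v 9,
      - v 0 - v 1 - v 3 - v 8 - v 9,
      - v 0 - v 1 - v 2 - v 8 - v 9,
      - v 0 - v 1 - v 5 - v 8 - v 9,
      - v 0 - v 1 - v 4 - v 8 - v 9,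
      - v 1 - v 9,
      - v 1 - v 8,
      - 2 * v 0 - 3 * v 1 - v 2 - v 3 - v 4 - v 5 - v 7 - 2 * v 8 - 2 * v 9,
      - 2 * v 0 - 3 * v 1 - v 2 - v 3 - v 4 - v 5 - v 6 - 2 * v 8 - 2 * v 9] := by
  ext i
  fin_cases i <;> simp [rho, act_mul, act_w0, act_w2, act_w3, act_sg3] <;> ring

lemma w0_mul_self : w0 * w0 = 1 := Units.ext w0.mul_inv

lemma w2_mul_self : w2 * w2 = 1 := Units.ext w2.mul_inv

lemma w3_mul_self : w3 * w3 = 1 := Units.ext w3.mul_inv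

lemma sg3_mul_self : sg3 * sg3 = 1 := Units.ext sg3.mul_inv

lemma a2e_mul_self : a2e * a2e = 1 := PicAut.ext_act fun v => by
  ext i; fin_cases i <;> simp [act_mul, act_one, act_a2e] <;> ring

lemma rho_mul_self : rho * rho = 1 := PicAut.ext_act fun v => by
  ext i; fin_cases i <;> simp [act_mul, act_one, act_rho] <;> ring

lemma commute_w0_sg3 : Commute w0 sg3 := PicAut.ext_act fun v => by
  ext i; fin_cases i <;> simp [act_mul, act_w0, act_sg3]

lemma commute_w2_sg3 : Commute w2 sg3 := PicAut.ext_act fun v => by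
  ext i; fin_cases i <;> simp [act_mul, act_w2, act_sg3]

lemma commute_w2_w0 : Commute w2 w0 := PicAut.ext_act fun v => by
  ext i; fin_cases i <;> simp [act_mul, act_w2, act_w0] <;> ring

lemma commute_w2_a2e : Commute w2 a2e := PicAut.ext_act fun v => by
  ext i; fin_cases i <;> simp [act_mul, act_w2, act_a2e] <;> ring

lemma commute_w2_b2e : Commute w2 b2e := PicAut.ext_act fun v => by
  ext i; fin_cases i <;> simp [act_mul, act_w2, act_b2e] <;> ring

lemma commute_w0_b2e : Commute w0 b2e := PicAut.ext_act fun v => by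
  ext i; fin_cases i <;> simp [act_mul, act_w0, act_b2e] <;> ring

lemma commute_a2e_sg3 : Commute a2e sg3 := PicAut.ext_act fun v => by
  ext i; fin_cases i <;> simp [act_mul, act_a2e, act_sg3] <;> ring

lemma commute_a2e_b2e : Commute a2e b2e := PicAut.ext_act fun v => by
  ext i; fin_cases i <;> simp [act_mul, act_a2e, act_b2e] <;> ring

lemma rho_mul_w0 : rho * w0 = a2e * rho := PicAut.ext_act fun v => by
  ext i; fin_cases i <;> simp [act_mul, act_rho, act_w0, act_a2e] <;> ring

lemma rho_mul_sg3 : rho * sg3 = b2e * rho := PicAut.ext_act fun v => by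
  ext i; fin_cases i <;> simp [act_mul, act_rho, act_sg3, act_b2e] <;> ring

lemma w3_w0_w3 : w3 * (w0 * w3) = w0 * w3 * w0 := PicAut.ext_act fun v => by
  ext i; fin_cases i <;> simp [act_mul, act_w3, act_w0] <;> ring

lemma w3_sg3_w0_w3 : w3 * (sg3 * w0 * w3) = sg3 * w0 * w3 * (rho * w2 * rho) :=
  PicAut.ext_act fun v => by
    ext i; fin_cases i <;> simp [act_mul, act_w3, act_w0, act_w2, act_rho, act_sg3] <;> ring

lemma w0_w3_sg3_w3 : w0 * (w3 * sg3 * w3) = w3 * sg3 * w3 * (rho * w2 * rho) :=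
  PicAut.ext_act fun v => by
    ext i; fin_cases i <;> simp [act_mul, act_w3, act_w0, act_w2, act_rho, act_sg3] <;> ring

lemma w2_w3_sg3_w3 : w2 * (w3 * sg3 * w3) = w3 * sg3 * w3 * a2e :=
  PicAut.ext_act fun v => by
    ext i; fin_cases i <;> simp [act_mul, act_w3, act_w2, act_sg3, act_a2e] <;> ring

lemma sg3_w3_sg3_w3 : sg3 * (w3 * sg3 * w3) = w3 * sg3 * w3 * sg3 :=
  PicAut.ext_act fun v => by
    ext i; fin_cases i <;> simp [act_mul, act_w3, act_sg3] <;> ring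

section Dihedral

variable {G : Type*} [Group G]

lemma mem_closure_induction_of_involutive {S : Set G} (hS : ∀ x ∈ S, x * x = 1) {p : G → Prop}
    (one : p 1) (mul : ∀ x ∈ S, ∀ y, p y → p (x * y)) {g : G} (hg : g ∈ Subgroup.closure S) :
    p g := by
  induction hg using Subgroup.closure_induction_left with
  | one => exact one
  | mul_left x hx y _ ih => exact mul x hx y ih
  | inv_mul_cancel x hx y _ ih =>
    rw [← eq_inv_of_mul_eq_one_left (hS x hx)]
    exact mul x hx y ih

lemma exists_zpow_of_mem_closure_pair {a b g : G} (ha : a * a = 1) (hb : b * b = 1)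
    (hg : g ∈ Subgroup.closure {a, b}) :
    ∃ k : ℤ, g = (b * a) ^ k ∨ g = (b * a) ^ k * a := by
  have ha' : a⁻¹ = a := inv_eq_of_mul_eq_one_left ha
  have hb' : b⁻¹ = b := inv_eq_of_mul_eq_one_left hb
  have hconj (k : ℤ) : a * (b * a) ^ k = (b * a) ^ (-k) * a := by
    have : a * (b * a) * a⁻¹ = (b * a)⁻¹ := by simp [ha', hb', mul_assoc, ha]
    rw [zpow_neg, ← inv_zpow, ← this, conj_zpow]
    simp
  refine mem_closure_induction_of_involutive (S := {a, b})
    (p := fun g => ∃ k : ℤ, g = (b * a) ^ k ∨ g = (b * a) ^ k * a) ?_ ⟨0, by simp⟩ ?_ hg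
  · rintro x (rfl | rfl) <;> assumption
  · have hbt : b = (b * a) * a := by rw [mul_assoc, ha, mul_one]
    rintro x (rfl | rfl) y ⟨k, rfl | rfl⟩
    · exact ⟨-k, Or.inr (hconj k)⟩
    · exact ⟨-k, Or.inl (by rw [← mul_assoc, hconj, mul_assoc, ha, mul_one])⟩
    · refine ⟨1 - k, Or.inr ?_⟩
      nth_rewrite 1 [hbt]
      rw [mul_assoc, hconj, ← mul_assoc, ← zpow_one_add, sub_eq_add_neg]
    · refine ⟨1 - k, Or.inl ?_⟩
      nth_rewrite 1 [hbt]
      rw [mul_assoc, ← mul_assoc a, hconj, mul_assoc _ a a, ha, mul_one, ← zpow_one_add,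
        sub_eq_add_neg]

end Dihedral

lemma act_zpow_of_translation {t : PicAut} {v e : Pic} (hv : act t v = v + e) (he : act t e = e)
    (k : ℤ) : act (t ^ k) v = v + k • e := by
  have het : t ∈ MulAction.stabilizer PicAut e := he
  have he' : act t⁻¹ e = e := inv_mem het
  have hez (k : ℤ) : act (t ^ k) e = e := zpow_mem het k
  have hv' : act t⁻¹ v = v - e := by
    rw [eq_sub_iff_add_eq]
    conv_lhs => rw [← he', ← act_add, ← hv, ← act_mul, inv_mul_cancel, act_one]
  induction k using Int.induction_on with
  | zero => simp [act_one]
  | succ k ih =>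
    rw [zpow_add_one, act_mul, hv, act_add, ih, hez]
    module
  | pred k ih =>
    rw [zpow_sub_one, act_mul, hv', sub_eq_add_neg, act_add, act_neg, ih, hez]
    module

lemma act_of_mem_closure_pair {a b z : PicAut} {v e : Pic} (ha : a * a = 1) (hb : b * b = 1)
    (hav : act a v = -v) (hv : act (b * a) v = v + e) (he : act (b * a) e = e)
    (hz : z ∈ Subgroup.closure {a, b}) :
    ∃ k : ℤ, act z v = v + k • e ∧ z = (b * a) ^ k ∨ act z v = -(v + k • e) := by
  obtain ⟨k, rfl | rfl⟩ := exists_zpow_of_mem_closure_pair ha hb hz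
  · exact ⟨k, Or.inl ⟨act_zpow_of_translation hv he k, rfl⟩⟩
  · exact ⟨k, Or.inr (by rw [act_mul, hav, act_neg, act_zpow_of_translation hv he])⟩

/-- Representatives of the six pairs `±γ` of long roots modulo `δ`: `longRep j` sends `α₂` to
a root in the `j`-th pair. -/
def longRep : Fin 6 → PicAut :=
  ![1, w3, sg3 * w3, w0 * w3, sg3 * w0 * w3, w3 * sg3 * w3]

/-- The subgroup `⟨s₀, s₂s₁s₃s₂s₃s₁s₂, s₃, s₂s₁s₀s₂s₃s₂s₀s₁s₂⟩`. -/
def stabGen : Subgroup PicAut := Subgroup.closure {w0, a2e, sg3, b2e}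

/-- The subgroup generated by `stabGen`, the reflection in `α₂` and `rho`; it preserves
`±α₂ + ℤδ`. -/
def linePreserver : Subgroup PicAut := Subgroup.closure {w2, rho} ⊔ stabGen

lemma w0_mem_stabGen : w0 ∈ stabGen := Subgroup.subset_closure (by simp)

lemma a2e_mem_stabGen : a2e ∈ stabGen := Subgroup.subset_closure (by simp)

lemma sg3_mem_stabGen : sg3 ∈ stabGen := Subgroup.subset_closure (by simp)

lemma b2e_mem_stabGen : b2e ∈ stabGen := Subgroup.subset_closure (by simp)

lemma stabGen_le_linePreserver : stabGen ≤ linePreserver := le_sup_right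

lemma w2_mem_linePreserver : w2 ∈ linePreserver :=
  Subgroup.mem_sup_left (Subgroup.subset_closure (by simp))

lemma rho_mem_linePreserver : rho ∈ linePreserver :=
  Subgroup.mem_sup_left (Subgroup.subset_closure (by simp))

lemma rho_mul_a2e : rho * a2e = w0 * rho := by
  calc rho * a2e = rho * (a2e * rho) * rho := by simp [mul_assoc, rho_mul_self]
    _ = w0 * rho := by rw [← rho_mul_w0, ← mul_assoc, rho_mul_self, one_mul]

lemma rho_mul_b2e : rho * b2e = sg3 * rho := by
  calc rho * b2e = rho * (b2e * rho) * rho := by simp [mul_assoc, rho_mul_self]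
    _ = sg3 * rho := by rw [← rho_mul_sg3, ← mul_assoc, rho_mul_self, one_mul]

lemma closure_w2_rho_le_normalizer :
    Subgroup.closure {w2, rho} ≤ Subgroup.normalizer (stabGen : Set PicAut) := by
  have key : ∀ x ∈ ({w2, rho} : Set PicAut), ∀ g ∈ stabGen, x * g * x⁻¹ ∈ stabGen := by
    intro x hx g hg
    have : stabGen ≤ stabGen.comap (MulAut.conj x).toMonoidHom := by
      refine (Subgroup.closure_le _).2 ?_
      rcases hx with rfl | rfl <;> rintro y (rfl | rfl | rfl | rfl) <;>
        simp only [Subgroup.coe_comap, Set.mem_preimage, SetLike.mem_coe,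
          MulEquiv.coe_toMonoidHom, MulAut.conj_apply]
      · simpa [commute_w2_w0.eq] using w0_mem_stabGen
      · simpa [commute_w2_a2e.eq] using a2e_mem_stabGen
      · simpa [commute_w2_sg3.eq] using sg3_mem_stabGen
      · simpa [commute_w2_b2e.eq] using b2e_mem_stabGen
      · simpa [rho_mul_w0] using a2e_mem_stabGen
      · simpa [rho_mul_a2e] using w0_mem_stabGen
      · simpa [rho_mul_sg3] using b2e_mem_stabGen
      · simpa [rho_mul_b2e] using sg3_mem_stabGen
    exact this hg
  refine (Subgroup.closure_le _).2 fun x hx => Subgroup.mem_normalizer_iff.2 fun g =>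
    ⟨key x hx g, fun h => ?_⟩
  have hxx : x * x = 1 := by
    rcases hx with rfl | rfl
    exacts [w2_mul_self, rho_mul_self]
  have hconj : x * (x * g * x⁻¹) * x⁻¹ = g := by
    rw [mul_assoc x g, ← mul_assoc x x, hxx, one_mul, mul_assoc, ← mul_inv_rev, hxx, inv_one,
      mul_one]
  exact hconj ▸ key x hx _ h

lemma mul_longRep {x : PicAut} (hx : x ∈ ({w0, w2, w3, sg3} : Set PicAut)) (j : Fin 6) :
    ∃ i, ∃ n ∈ linePreserver, x * longRep j = longRep i * n := by
  have cancel {y : PicAut} (hy : y * y = 1) (g : PicAut) : y * (y * g) = g := by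
    rw [← mul_assoc, hy, one_mul]
  have c02 : w2 * w0 = w0 * w2 := commute_w2_w0
  have c23 : w2 * sg3 = sg3 * w2 := commute_w2_sg3
  have c03 : w0 * sg3 = sg3 * w0 := commute_w0_sg3
  have hw0 := stabGen_le_linePreserver w0_mem_stabGen
  have ha2e := stabGen_le_linePreserver a2e_mem_stabGen
  have hsg3 := stabGen_le_linePreserver sg3_mem_stabGen
  have hw2 := w2_mem_linePreserver
  have hrho := rho_mem_linePreserver
  have h2 : w2 * w3 = sg3 * w0 * w3 * rho := by
    simp only [rho, mul_assoc, cancel w3_mul_self, cancel w0_mul_self]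
    rw [← mul_assoc w2, c23, mul_assoc, cancel sg3_mul_self]
  rcases hx with rfl | rfl | rfl | rfl
  · fin_cases j
    · exact ⟨0, w0, hw0, by simp [longRep]⟩
    · exact ⟨3, 1, one_mem _, by simp [longRep]⟩
    · exact ⟨4, 1, one_mem _, by simp [longRep, ← mul_assoc, c03]⟩
    · exact ⟨1, 1, one_mem _, by simp [longRep, mul_assoc, cancel w0_mul_self]⟩
    · exact ⟨2, 1, one_mem _, by
        simp [longRep, mul_assoc, ← c03, cancel w0_mul_self]⟩
    · exact ⟨5, _, mul_mem (mul_mem hrho hw2) hrho, w0_w3_sg3_w3⟩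
  · fin_cases j
    · exact ⟨0, w2, hw2, by simp [longRep]⟩
    · exact ⟨4, rho, hrho, h2⟩
    · refine ⟨3, rho, hrho, ?_⟩
      change w2 * (sg3 * w3) = w0 * w3 * rho
      rw [← mul_assoc, c23, mul_assoc, h2]
      simp only [mul_assoc, cancel sg3_mul_self]
    · refine ⟨2, rho, hrho, ?_⟩
      change w2 * (w0 * w3) = sg3 * w3 * rho
      rw [← mul_assoc, c02, mul_assoc, h2, ← c03]
      simp only [mul_assoc, cancel w0_mul_self]
    · refine ⟨1, rho, hrho, ?_⟩
      change w2 * (sg3 * w0 * w3) = w3 * rho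
      rw [← c03]
      calc w2 * (w0 * sg3 * w3) = w0 * (sg3 * (w2 * w3)) := by
            rw [← mul_assoc sg3, ← c23]
            simp only [← mul_assoc, c02]
        _ = w3 * rho := by
            rw [h2]
            simp only [mul_assoc, cancel sg3_mul_self, cancel w0_mul_self]
    · exact ⟨5, a2e, ha2e, w2_w3_sg3_w3⟩
  · fin_cases j
    · exact ⟨1, 1, one_mem _, by simp [longRep]⟩
    · exact ⟨0, 1, one_mem _, by simp [longRep, w3_mul_self]⟩
    · exact ⟨5, 1, one_mem _, by simp [longRep, mul_assoc]⟩
    · exact ⟨3, w0, hw0, w3_w0_w3⟩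
    · exact ⟨4, _, mul_mem (mul_mem hrho hw2) hrho, w3_sg3_w0_w3⟩
    · exact ⟨2, 1, one_mem _, by simp [longRep, mul_assoc, cancel w3_mul_self]⟩
  · fin_cases j
    · exact ⟨0, sg3, hsg3, by simp [longRep]⟩
    · exact ⟨2, 1, one_mem _, by simp [longRep]⟩
    · exact ⟨1, 1, one_mem _, by simp [longRep, mul_assoc, cancel sg3_mul_self]⟩
    · exact ⟨4, 1, one_mem _, by simp [longRep, mul_assoc]⟩
    · exact ⟨3, 1, one_mem _, by simp [longRep, mul_assoc, cancel sg3_mul_self]⟩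
    · exact ⟨5, sg3, hsg3, sg3_w3_sg3_w3⟩

lemma exists_longRep_mul {g : PicAut} (hg : g ∈ WB) :
    ∃ j, ∃ n ∈ linePreserver, g = longRep j * n := by
  refine mem_closure_induction_of_involutive (S := {w0, w2, w3, sg3})
    (p := fun g => ∃ j, ∃ n ∈ linePreserver, g = longRep j * n) ?_
    ⟨0, 1, one_mem _, by simp [longRep]⟩ ?_ hg
  · rintro x (rfl | rfl | rfl | rfl)
    exacts [w0_mul_self, w2_mul_self, w3_mul_self, sg3_mul_self]
  · rintro x hx y ⟨j, n, hn, rfl⟩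
    obtain ⟨i, m, hm, h⟩ := mul_longRep hx j
    exact ⟨i, m * n, mul_mem hm hn, by rw [← mul_assoc, h, mul_assoc]⟩

lemma stabGen_le_stabilizer : stabGen ≤ MulAction.stabilizer PicAut al2 := by
  refine (Subgroup.closure_le _).2 ?_
  rintro x (rfl | rfl | rfl | rfl)
  · show act w0 al2 = al2
    ext i; fin_cases i <;> simp [act_w0, al2]
  · show act a2e al2 = al2
    ext i; fin_cases i <;> simp [act_a2e, al2]
  · show act sg3 al2 = al2
    ext i; fin_cases i <;> simp [act_sg3, al2]
  · show act b2e al2 = al2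
    ext i; fin_cases i <;> simp [act_b2e, al2]

lemma stabGen_le_WB : stabGen ≤ WB := by
  have h0 : w0 ∈ WB := Subgroup.subset_closure (by simp)
  have h2 : w2 ∈ WB := Subgroup.subset_closure (by simp)
  have h3 : w3 ∈ WB := Subgroup.subset_closure (by simp)
  have hs : sg3 ∈ WB := Subgroup.subset_closure (by simp)
  refine (Subgroup.closure_le _).2 ?_
  rintro x (rfl | rfl | rfl | rfl)
  · exact h0
  · simp only [a2e, SetLike.mem_coe]
    apply_rules [mul_mem]
  · exact hs
  · simp only [b2e, SetLike.mem_coe]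
    apply_rules [mul_mem]

lemma WB_inf_stabilizer_le : WB ⊓ MulAction.stabilizer PicAut al2 ≤ stabGen := by
  rintro g ⟨hg, hfix : act g al2 = al2⟩
  obtain ⟨j, n, hn, rfl⟩ := exists_longRep_mul hg
  have hn' : n ∈ (Subgroup.closure {w2, rho} : Set PicAut) * (stabGen : Set PicAut) := by
    rw [← Subgroup.coe_mul_of_left_le_normalizer_right _ _ closure_w2_rho_le_normalizer]
    exact hn
  obtain ⟨z, hz, κ, hκ, rfl : z * κ = n⟩ := hn'
  have hκfix : act κ al2 = al2 := stabGen_le_stabilizer hκ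
  have hw2 : act w2 al2 = -al2 := by
    ext i; fin_cases i <;> simp [act_w2, al2]
  have ht : act (rho * w2) al2 = al2 + -dl := by
    rw [act_mul, hw2]
    ext i; fin_cases i <;> simp [act_rho, al2, dl]
  have hd : act (rho * w2) (-dl) = -dl := by
    ext i; fin_cases i <;> simp [act_mul, act_rho, act_w2, dl]
  obtain ⟨k, hk⟩ := act_of_mem_closure_pair w2_mul_self rho_mul_self hw2 ht hd hz
  rw [act_mul, act_mul, hκfix] at hfix
  have hj : j = 0 ∧ k = 0 ∧ z = (rho * w2) ^ k := by
    rcases hk with ⟨hk, hzk⟩ | hk <;> rw [hk] at hfix <;>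
    have h0 := congrFun hfix 0 <;> have h1 := congrFun hfix 1 <;>
    have h2 := congrFun hfix 2 <;> have h4 := congrFun hfix 4 <;>
    have h6 := congrFun hfix 6 <;> have h8 := congrFun hfix 8 <;>
    fin_cases j <;>
    simp [longRep, act_one, act_mul, act_w3, act_sg3, act_w0, al2, dl] at h0 h1 h2 h4 h6 h8 <;>
    first
    | omega
    | exact ⟨rfl, by omega, hzk⟩
  obtain ⟨rfl, rfl, rfl⟩ := hj
  simpa [longRep] using hκ

lemma closure_inf_closure_eq_bot :
    Subgroup.closure {w0, a2e} ⊓ Subgroup.closure {sg3, b2e} = ⊥ := by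
  refine (Subgroup.eq_bot_iff_forall _).2 ?_
  rintro g ⟨hg, hg'⟩
  have hle : Subgroup.closure {sg3, b2e} ≤ MulAction.stabilizer PicAut al0 := by
    refine (Subgroup.closure_le _).2 ?_
    rintro x (rfl | rfl)
    · show act sg3 al0 = al0
      ext i; fin_cases i <;> simp [act_sg3, al0]
    · show act b2e al0 = al0
      ext i; fin_cases i <;> simp [act_b2e, al0]
  have hfix : act g al0 = al0 := hle hg'
  have hw0 : act w0 al0 = -al0 := by
    ext i; fin_cases i <;> simp [act_w0, al0]
  have ht : act (a2e * w0) al0 = al0 + (-2 : ℤ) • dl := by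
    rw [act_mul, hw0]
    ext i; fin_cases i <;> simp [act_a2e, al0, dl]
  have hd : act (a2e * w0) ((-2 : ℤ) • dl) = (-2 : ℤ) • dl := by
    rw [act_zsmul]
    congr 1
    ext i; fin_cases i <;> simp [act_mul, act_a2e, act_w0, dl]
  obtain ⟨k, hk⟩ := act_of_mem_closure_pair w0_mul_self a2e_mul_self hw0 ht hd hg
  rcases hk with ⟨hk, rfl⟩ | hk <;> rw [hk] at hfix <;>
    have h0 := congrFun hfix 0 <;> have h1 := congrFun hfix 1 <;> simp [al0, dl] at h0 h1
  · simp [h0]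
  · omega

/-- The stabilizer of the root `b₁ = α₂` in `W_B` is generated by `s₀`,
`s₂s₁s₃s₂s₃s₁s₂`, `s₃` and `s₂s₁s₀s₂s₃s₂s₀s₁s₂`; the first two elements commute
with the last two, and the stabilizer is the (internal) direct product of
`⟨s₀, s₂s₁s₃s₂s₃s₁s₂⟩` and `⟨s₃, s₂s₁s₀s₂s₃s₂s₀s₁s₂⟩`. -/
theorem stmt9 :
    WB ⊓ MulAction.stabilizer PicAut (al2 : Pic) = Subgroup.closure {w0, a2e, sg3, b2e} ∧
    Commute w0 sg3 ∧ Commute w0 b2e ∧ Commute a2e sg3 ∧ Commute a2e b2e ∧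
    Subgroup.closure {w0, a2e} ⊓ Subgroup.closure {sg3, b2e} = ⊥ ∧
    ((WB ⊓ MulAction.stabilizer PicAut (al2 : Pic) : Subgroup PicAut) : Set PicAut) =
      (Subgroup.closure {w0, a2e} : Set PicAut) * (Subgroup.closure {sg3, b2e} : Set PicAut) := by
  have hstab : WB ⊓ MulAction.stabilizer PicAut (al2 : Pic) = stabGen :=
    le_antisymm WB_inf_stabilizer_le (le_inf stabGen_le_WB stabGen_le_stabilizer)
  refine ⟨hstab, commute_w0_sg3, commute_w0_b2e, commute_a2e_sg3, commute_a2e_b2e,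
    closure_inf_closure_eq_bot, ?_⟩
  have hcomm : Subgroup.closure {w0, a2e} ≤
      Subgroup.centralizer (Subgroup.closure {sg3, b2e} : Set PicAut) := by
    rw [Subgroup.centralizer_closure, Subgroup.closure_le]
    rintro x (rfl | rfl) y (rfl | rfl)
    exacts [commute_w0_sg3.symm, commute_w0_b2e.symm, commute_a2e_sg3.symm, commute_a2e_b2e.symm]
  rw [hstab, ← Subgroup.coe_mul_of_left_le_normalizer_right _ _
    (hcomm.trans (Subgroup.centralizer_le_normalizer _)), ← Subgroup.closure_union, stabGen,
    Set.insert_union, Set.singleton_union]
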